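/- arXiv:1404.2972 — 2 statements merged into one kernel-verified Lean document; each statement's English description precedes it below -/
import Mathlib

section
/- Let A and B be separable metric spaces with B nonempty, let G be a Borel subset of ℝ^d, and let F : A × B × ℝ^d → ℝ be a function such that for each fixed β ∈ B the map (α,x) ↦ F(α,β,x) is Borel measurable on A × ℝ^d, and for each fixed (α,x) ∈ A × ℝ^d the map β ↦ F(α,β,x) is continuous on B. Assume that for every α ∈ A and every x ∈ G one has inf_{β∈B} F(α,β,x) ≤ 0. Then for every ε > 0 and every β* ∈ B there exists a Borel measurable function φ : A × ℝ^d → B taking at most countably many values such that F(α, φ(α,x), x) ≤ ε for all α ∈ A and x ∈ G, and φ(α,x) = β* whenever x ∉ G. -/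
open scoped BigOperators

/-- ε-optimal Borel selection of the minimizing player's response (Lemma 1.16.1 of the paper):
if `A`, `B` are separable metric spaces, `F(α,β,x)` is Borel in `(α,x)` for each `β`,
continuous in `β` for each `(α,x)`, and `inf_{β} F(α,β,x) ≤ 0` for `x ∈ G`, then for every
`ε > 0` and `β* ∈ B` there is a countably-valued Borel map `φ : A × ℝ^d → B` with
`F(α, φ(α,x), x) ≤ ε` on `G` and `φ = β*` off `G`. -/
theorem exists_borel_countable_selection_inf {d : ℕ}
    {A B : Type*} [MetricSpace A] [TopologicalSpace.SeparableSpace A]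
    [MeasurableSpace A] [BorelSpace A]
    [MetricSpace B] [TopologicalSpace.SeparableSpace B]
    [MeasurableSpace B] [BorelSpace B] [Nonempty B]
    (G : Set (EuclideanSpace ℝ (Fin d))) (hG : MeasurableSet G)
    (F : A → B → EuclideanSpace ℝ (Fin d) → ℝ)
    (hFmeas : ∀ β : B, Measurable fun p : A × EuclideanSpace ℝ (Fin d) => F p.1 β p.2)
    (hFcont : ∀ (α : A) (x : EuclideanSpace ℝ (Fin d)), Continuous fun β : B => F α β x)
    (hinf : ∀ (α : A), ∀ x ∈ G, (⨅ β : B, F α β x) ≤ 0)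
    (ε : ℝ) (hε : 0 < ε) (βstar : B) :
    ∃ φ : A × EuclideanSpace ℝ (Fin d) → B,
      Measurable φ ∧ (Set.range φ).Countable ∧
      (∀ (α : A), ∀ x ∈ G, F α (φ (α, x)) x ≤ ε) ∧
      (∀ (α : A) (x : EuclideanSpace ℝ (Fin d)), x ∉ G → φ (α, x) = βstar) := by
  classical
  let u := TopologicalSpace.denseSeq B
  have hex : ∀ q : A × EuclideanSpace ℝ (Fin d), ∃ n, q.2 ∉ G ∨ F q.1 (u n) q.2 ≤ ε := by
    intro q
    by_cases hq : q.2 ∈ G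
    · obtain ⟨β, hβ⟩ := exists_lt_of_ciInf_lt ((hinf q.1 q.2 hq).trans_lt hε)
      obtain ⟨n, hn⟩ := (TopologicalSpace.denseRange_denseSeq B).exists_mem_open
        (isOpen_Iio.preimage (hFcont q.1 q.2)) ⟨β, hβ⟩
      exact ⟨n, Or.inr (le_of_lt hn)⟩
    · exact ⟨0, Or.inl hq⟩
  have hidx : Measurable fun q => Nat.find (hex q) :=
    measurable_find hex fun n =>
      (measurable_snd hG).compl.union (measurableSet_le (hFmeas (u n)) measurable_const)
  refine ⟨fun q => if q.2 ∈ G then u (Nat.find (hex q)) else βstar,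
    Measurable.ite (measurable_snd hG) ((measurable_from_nat (f := u)).comp hidx)
      measurable_const, ?_, ?_, fun α x hx => if_neg hx⟩
  · refine ((Set.countable_range u).insert βstar).mono ?_
    rintro _ ⟨q, rfl⟩
    dsimp only
    split_ifs
    · exact Or.inr ⟨_, rfl⟩
    · exact Or.inl rfl
  · intro α x hx
    simpa [hx] using (Nat.find_spec (hex (α, x))).resolve_left (not_not_intro hx)
end

section
/- Let A be a nonempty separable metric space, let G be a Borel subset of ℝ^d, and let h : A × ℝ^d → ℝ be a function such that for each fixed α ∈ A the map x ↦ h(α,x) is Borel measurable, and for each fixed x ∈ ℝ^d the map α ↦ h(α,x) is continuous. Assume that sup_{α∈A} h(α,x) ≥ 0 for every x ∈ G. Then for every ε > 0 and every α* ∈ A there exists a Borel measurable function ᾱ : ℝ^d → A taking at most countably many values such that h(ᾱ(x), x) ≥ −ε for all x ∈ G, and ᾱ(x) = α* whenever x ∉ G. -/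
open scoped BigOperators

/-- A continuous function on a separable space exceeds, along a dense sequence, any number
smaller than its supremum. -/
theorem exists_denseSeq_lt_of_lt_ciSup {A : Type*} [TopologicalSpace A]
    [TopologicalSpace.SeparableSpace A] [Nonempty A] {f : A → ℝ} (hf : Continuous f) {c : ℝ}
    (hc : c < ⨆ α, f α) : ∃ n, c < f (TopologicalSpace.denseSeq A n) := by
  obtain ⟨α, hα⟩ := exists_lt_of_lt_ciSup hc
  obtain ⟨_, hβ, n, rfl⟩ := (TopologicalSpace.denseRange_denseSeq A).inter_open_nonempty _
    (isOpen_lt continuous_const hf) ⟨α, hα⟩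
  exact ⟨n, hβ⟩

/-- ε-optimal Borel selection of the maximizing player's control (Lemma 1.17.2 of the paper):
if `A` is a nonempty separable metric space, `h(α,x)` is Borel in `x` for each `α`,
continuous in `α` for each `x`, and `sup_{α} h(α,x) ≥ 0` for `x ∈ G`, then for every `ε > 0`
and `α* ∈ A` there is a countably-valued Borel map `ᾱ : ℝ^d → A` with `h(ᾱ(x), x) ≥ -ε` on `G`
and `ᾱ = α*` off `G`. -/
theorem exists_borel_countable_selection_sup {d : ℕ}
    {A : Type*} [MetricSpace A] [TopologicalSpace.SeparableSpace A]
    [MeasurableSpace A] [BorelSpace A] [Nonempty A]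
    (G : Set (EuclideanSpace ℝ (Fin d))) (hG : MeasurableSet G)
    (h : A → EuclideanSpace ℝ (Fin d) → ℝ)
    (hhmeas : ∀ α : A, Measurable fun x : EuclideanSpace ℝ (Fin d) => h α x)
    (hhcont : ∀ x : EuclideanSpace ℝ (Fin d), Continuous fun α : A => h α x)
    (hsup : ∀ x ∈ G, 0 ≤ ⨆ α : A, h α x)
    (ε : ℝ) (hε : 0 < ε) (αstar : A) :
    ∃ abar : EuclideanSpace ℝ (Fin d) → A,
      Measurable abar ∧ (Set.range abar).Countable ∧
      (∀ x ∈ G, -ε ≤ h (abar x) x) ∧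
      (∀ x : EuclideanSpace ℝ (Fin d), x ∉ G → abar x = αstar) := by
  classical
  have hex : ∀ x, ∃ n : ℕ, x ∉ G ∨ -ε < h (TopologicalSpace.denseSeq A n) x := fun x => by
    by_cases hx : x ∈ G
    · obtain ⟨n, hn⟩ := exists_denseSeq_lt_of_lt_ciSup (hhcont x)
        ((neg_lt_zero.mpr hε).trans_le (hsup x hx))
      exact ⟨n, Or.inr hn⟩
    · exact ⟨0, Or.inl hx⟩
  have hfind : Measurable fun x => Nat.find (hex x) := measurable_find hex fun n =>
    hG.compl.union (measurableSet_lt measurable_const (hhmeas _))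
  refine ⟨fun x => if x ∈ G then TopologicalSpace.denseSeq A (Nat.find (hex x)) else αstar,
    Measurable.ite hG (measurable_from_nat.comp hfind) measurable_const, ?_, ?_, ?_⟩
  · refine ((Set.countable_range (TopologicalSpace.denseSeq A)).insert αstar).mono ?_
    rintro _ ⟨x, rfl⟩
    dsimp only
    split_ifs
    · exact Or.inr ⟨_, rfl⟩
    · exact Or.inl rfl
  · intro x hx
    simpa only [if_pos hx] using ((Nat.find_spec (hex x)).resolve_left (not_not.mpr hx)).le
  · intro x hx
    exact if_neg hx
end
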